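/- Let K be an algebraically closed field of characteristic 5 and let τ = 4 ∈ K (which satisfies τ² − 3τ + 1 = 0 in characteristic 5). Consider the quadratic forms q₁ = XY − τ·XZ + (τ−1)·YZ and q₂ = (τ−2)Y² + Z² − (τ−1)·XY − XZ + YZ over K. Then: (i) the point p = (1 : 2(τ−1) : 2(2−τ)) equals d = (1:1:1); (ii) both q₁ and q₂ are nondegenerate quadratic forms vanishing at d, and their gradient vectors at (1,1,1) are nonzero and proportional, i.e., the two conics have the same tangent line at d (they are tangent at d); (iii) the common zero locus of q₁ and q₂ in ℙ²(K) is exactly the three points a = (1:0:0), d = (1:1:1), e = (3:2:1). -/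

import Mathlib

/-!
STATEMENT 5: Over an algebraically closed field `K` of characteristic 5 with `τ = 4`
(a root of `x² − 3x + 1`), the reductions of the two Grünbaum conics satisfy:
(i) `p = (1 : 2(τ−1) : 2(2−τ))` equals `d = (1:1:1)`;
(ii) both `q₁` and `q₂` are nondegenerate, vanish at `d`, and their gradients at `(1,1,1)` are
nonzero and proportional (the conics are tangent at `d`);
(iii) the common zero locus of `q₁` and `q₂` in `ℙ²(K)` is exactly `{a, d, e}` with
`a = (1:0:0)`, `d = (1:1:1)`, `e = (3:2:1)`.
-/

open MvPolynomial

noncomputable def grunQ1 (K : Type*) [Field K] (τ : K) : MvPolynomial (Fin 3) K :=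
  X 0 * X 1 - C τ * (X 0 * X 2) + C (τ - 1) * (X 1 * X 2)

noncomputable def grunQ2 (K : Type*) [Field K] (τ : K) : MvPolynomial (Fin 3) K :=
  C (τ - 2) * X 1 ^ 2 + X 2 ^ 2 - C (τ - 1) * (X 0 * X 1) - X 0 * X 2 + X 1 * X 2

/-- The symmetric matrix associated to a quadratic form `q` in three variables:
`A i j = (1/2)·∂i∂j q`. -/
noncomputable def assocMatrix {K : Type*} [Field K] (q : MvPolynomial (Fin 3) K) :
    Matrix (Fin 3) (Fin 3) K :=
  fun i j => (2 : K)⁻¹ * eval (fun _ => 0) (pderiv i (pderiv j q))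

/-- The gradient vector of `q` at the point `pt`. -/
noncomputable def gradAt {K : Type*} [Field K] (q : MvPolynomial (Fin 3) K)
    (pt : Fin 3 → K) : Fin 3 → K :=
  fun i => eval pt (pderiv i q)

lemma vec3_ne_zero_of_coord {K : Type*} [Field K] (v : Fin 3 → K) (j : Fin 3)
    (h : v j ≠ 0) : v ≠ 0 :=
  fun hv => h (by rw [hv]; rfl)

lemma eval_grunQ1 {K : Type*} [Field K] (τ : K) (v : Fin 3 → K) :
    eval v (grunQ1 K τ) = v 0 * v 1 - τ * (v 0 * v 2) + (τ - 1) * (v 1 * v 2) := by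
  simp [grunQ1]

lemma eval_grunQ2 {K : Type*} [Field K] (τ : K) (v : Fin 3 → K) :
    eval v (grunQ2 K τ) = (τ - 2) * v 1 ^ 2 + v 2 ^ 2 - (τ - 1) * (v 0 * v 1)
      - v 0 * v 2 + v 1 * v 2 := by
  simp [grunQ2]

lemma gradAt_grunQ1 {K : Type*} [Field K] (τ : K) (v : Fin 3 → K) :
    gradAt (grunQ1 K τ) v =
      ![v 1 - τ * v 2, v 0 + (τ - 1) * v 2, -τ * v 0 + (τ - 1) * v 1] := by
  ext i
  fin_cases i <;> simp [gradAt, grunQ1, pderiv_X]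

lemma gradAt_grunQ2 {K : Type*} [Field K] (τ : K) (v : Fin 3 → K) :
    gradAt (grunQ2 K τ) v =
      ![-(τ - 1) * v 1 - v 2, 2 * (τ - 2) * v 1 - (τ - 1) * v 0 + v 2,
        2 * v 2 - v 0 + v 1] := by
  ext i
  fin_cases i <;> simp [gradAt, grunQ2, pderiv_X] <;> ring

lemma assocMatrix_grunQ1 {K : Type*} [Field K] (τ : K) :
    assocMatrix (grunQ1 K τ) =
      (2 : K)⁻¹ • !![0, 1, -τ; 1, 0, τ - 1; -τ, τ - 1, 0] := by
  ext i j
  fin_cases i <;> fin_cases j <;> simp [assocMatrix, grunQ1, pderiv_X]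

lemma assocMatrix_grunQ2 {K : Type*} [Field K] (τ : K) :
    assocMatrix (grunQ2 K τ) =
      (2 : K)⁻¹ • !![0, -(τ - 1), -1; -(τ - 1), 2 * (τ - 2), 1; -1, 1, 2] := by
  have h : constantCoeff (2 : MvPolynomial (Fin 3) K) = 2 := map_ofNat _ 2
  ext i j
  fin_cases i <;> fin_cases j <;> simp [assocMatrix, grunQ2, pderiv_X, h, mul_comm]

/-- In characteristic 5 the eliminant of the first coordinate from the two conics with `τ = 4`
is `2 (y - z) ^ 2 (y - 2 z)`, and it has a double root at `(1 : 1 : 1)`. -/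
lemma common_zero_iff {K : Type*} [Field K] (h5 : (5 : K) = 0) (h2 : (2 : K) ≠ 0) (x y z : K) :
    (x * y - 4 * (x * z) + (4 - 1) * (y * z) = 0 ∧
      (4 - 2) * y ^ 2 + z ^ 2 - (4 - 1) * (x * y) - x * z + y * z = 0) ↔
    ((y = 0 ∧ z = 0) ∨ (x = z ∧ y = z) ∨ (x = 3 * z ∧ y = 2 * z)) := by
  constructor
  · rintro ⟨h₁, h₂⟩
    have helim : 2 * ((y - z) ^ 2 * (y - 2 * z)) = 0 := by
      linear_combination (y + z) * h₂ + (3 * y + z) * h₁ +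
        (3 * x * y * z + x * z ^ 2 - 4 * y ^ 2 * z + y * z ^ 2 - z ^ 3) * h5
    have h3 : (3 : K) ≠ 0 := by grind
    rcases mul_eq_zero.mp ((mul_eq_zero.mp helim).resolve_left h2) with h | h
    · obtain rfl : y = z := sub_eq_zero.mp (pow_eq_zero_iff two_ne_zero |>.mp h)
      have hfac : 3 * (y * (x - y)) = 0 := by linear_combination -h₁
      grind
    · obtain rfl : y = 2 * z := sub_eq_zero.mp h
      have hfac : 2 * (z * (x - 3 * z)) = 0 := by linear_combination -h₁
      grind
  · rintro (⟨rfl, rfl⟩ | ⟨rfl, rfl⟩ | ⟨rfl, rfl⟩)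
    · simp
    · constructor <;> ring
    · constructor
      · ring
      · linear_combination -2 * z ^ 2 * h5

theorem grunbaum_conics_tangent_char5
    (K : Type*) [Field K] [IsAlgClosed K] [CharP K 5] :
    let τ : K := 4
    let A : Projectivization K (Fin 3 → K) := Projectivization.mk K (![1, 0, 0] : Fin 3 → K)
      (vec3_ne_zero_of_coord _ 0 one_ne_zero)
    let D : Projectivization K (Fin 3 → K) := Projectivization.mk K (![1, 1, 1] : Fin 3 → K)
      (vec3_ne_zero_of_coord _ 0 one_ne_zero)
    let E : Projectivization K (Fin 3 → K) := Projectivization.mk K (![3, 2, 1] : Fin 3 → K)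
      (vec3_ne_zero_of_coord _ 2 one_ne_zero)
    -- τ = 4 is a root of x² − 3x + 1 in characteristic 5
    τ ^ 2 - 3 * τ + 1 = 0 ∧
    -- (i) the fourth intersection point `p` coincides with `d`
    (Projectivization.mk K (![1, 2 * (τ - 1), 2 * (2 - τ)] : Fin 3 → K)
      (vec3_ne_zero_of_coord _ 0 one_ne_zero) = D) ∧
    -- (ii) nondegeneracy, vanishing at `d`, and tangency at `d`
    (assocMatrix (grunQ1 K τ)).det ≠ 0 ∧ (assocMatrix (grunQ2 K τ)).det ≠ 0 ∧
    eval (![1, 1, 1] : Fin 3 → K) (grunQ1 K τ) = 0 ∧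
    eval (![1, 1, 1] : Fin 3 → K) (grunQ2 K τ) = 0 ∧
    gradAt (grunQ1 K τ) ![1, 1, 1] ≠ 0 ∧ gradAt (grunQ2 K τ) ![1, 1, 1] ≠ 0 ∧
    (∃ c : K, c ≠ 0 ∧
      gradAt (grunQ2 K τ) ![1, 1, 1] = c • gradAt (grunQ1 K τ) ![1, 1, 1]) ∧
    -- (iii) the common zero locus is exactly {a, d, e}, three distinct points
    (A ≠ D ∧ A ≠ E ∧ D ≠ E) ∧
    ∀ Q : Projectivization K (Fin 3 → K),
      (eval Q.rep (grunQ1 K τ) = 0 ∧ eval Q.rep (grunQ2 K τ) = 0) ↔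
        (Q = A ∨ Q = D ∨ Q = E) := by
  intro τ A D E
  have h5 : (5 : K) = 0 := by exact_mod_cast CharP.cast_eq_zero K 5
  have h2 : (2 : K) ≠ 0 := by grind
  have hdet₁ : (!![0, 1, -4; 1, 0, 4 - 1; -4, 4 - 1, 0] : Matrix (Fin 3) (Fin 3) K).det = 1 := by
    simp [Matrix.det_fin_three]
    linear_combination -5 * h5
  have hdet₂ : (!![0, -(4 - 1), -1; -(4 - 1), 2 * (4 - 2), 1; -1, 1, 2] :
      Matrix (Fin 3) (Fin 3) K).det = -1 := by
    simp [Matrix.det_fin_three]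
    linear_combination -3 * h5
  refine ⟨by grind, ?_, ?_, ?_, ?_, ?_, ?_, ?_, ⟨3, by grind, ?_⟩, ⟨?_, ?_, ?_⟩, fun Q => ?_⟩
  · rw [Projectivization.mk_eq_mk_iff']
    refine ⟨1, ?_⟩
    ext i
    fin_cases i <;> simp [τ] <;> grind
  · rw [assocMatrix_grunQ1, Matrix.det_smul, hdet₁]
    simp [h2]
  · rw [assocMatrix_grunQ2, Matrix.det_smul, hdet₂]
    simp [h2]
  · simp [eval_grunQ1, τ]
  · simp [eval_grunQ2, τ]
    grind
  · refine vec3_ne_zero_of_coord _ 0 ?_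
    simp [gradAt_grunQ1, τ]
    grind
  · refine vec3_ne_zero_of_coord _ 0 ?_
    simp [gradAt_grunQ2, τ]
    grind
  · ext i
    fin_cases i <;> simp [gradAt_grunQ1, gradAt_grunQ2, τ] <;> grind
  · rw [Ne, Projectivization.mk_eq_mk_iff']
    rintro ⟨a, ha⟩
    have h₀ := congrFun ha 0
    have h₁ := congrFun ha 1
    simp at h₀ h₁
    grind
  · rw [Ne, Projectivization.mk_eq_mk_iff']
    rintro ⟨a, ha⟩
    have h₀ := congrFun ha 0
    have h₁ := congrFun ha 2
    simp at h₀ h₁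
    grind
  · rw [Ne, Projectivization.mk_eq_mk_iff']
    rintro ⟨a, ha⟩
    have h₁ := congrFun ha 1
    have h₂ := congrFun ha 2
    simp at h₁ h₂
    grind
  · rw [eval_grunQ1, eval_grunQ2, common_zero_iff h5 h2]
    have eq_mk_iff (w : Fin 3 → K) (hw : w ≠ 0) :
        Q = Projectivization.mk K w hw ↔
          ∃ a : K, a * w 0 = Q.rep 0 ∧ a * w 1 = Q.rep 1 ∧ a * w 2 = Q.rep 2 := by
      conv_lhs => rw [← Q.mk_rep]
      rw [Projectivization.mk_eq_mk_iff']
      simp [_root_.funext_iff, Fin.forall_fin_succ]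
    simp only [A, D, E, eq_mk_iff]
    simp
    grind
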